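/- Let α ∈ (-1,1). Suppose E_k ⊆ [-1,1]² are sets of finite perimeter with Leb(E_k) ≤ 2+α whose conductances I_τ(∂E_k)/Leb(E_k) tend to ψ_τ^(2+α) as k → ∞. Then liminf_{k→∞} Leb(E_k) > 0, and if moreover E_k → E in L¹-sense for some Borel set E ⊆ [-1,1]², then E ∈ 𝒞_τ^(2+α). -/

import Mathlib

open MeasureTheory Set Filter ENNReal

noncomputable section

/-- The closed square `[-1,1]²` in `ℝ × ℝ`. -/
def Isq : Set (ℝ × ℝ) := Set.Icc (-1, -1) (1, 1)

/-- The open square `(-1,1)²` in `ℝ × ℝ`. -/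
def Osq : Set (ℝ × ℝ) := Set.Ioo (-1, -1) (1, 1)

/-- `τ` is a norm on `ℝ²`. -/
def IsNorm2 (τ : ℝ × ℝ → ℝ) : Prop :=
  (∀ x, τ x = 0 ↔ x = 0) ∧ (∀ (c : ℝ) (x), τ (c • x) = |c| * τ x) ∧
    ∀ x y, τ (x + y) ≤ τ x + τ y

/-- The Euclidean norm on `ℝ × ℝ`. -/
def eNorm2 (v : ℝ × ℝ) : ℝ := Real.sqrt (v.1 ^ 2 + v.2 ^ 2)

/-- The dual norm `τ*` of a norm `τ` on `ℝ²`. -/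
def dualNorm (τ : ℝ × ℝ → ℝ) (w : ℝ × ℝ) : ℝ :=
  sSup {x | ∃ v : ℝ × ℝ, τ v ≤ 1 ∧ x = v.1 * w.1 + v.2 * w.2}

/-- The divergence of a vector field on `ℝ²`. -/
def div2 (f : ℝ × ℝ → ℝ × ℝ) (x : ℝ × ℝ) : ℝ :=
  (fderiv ℝ f x (1, 0)).1 + (fderiv ℝ f x (0, 1)).2

/-- The perimeter `per(∂E)` of a set `E ⊆ ℝ²`, as the supremum of `∫_E div f`
over smooth compactly supported vector fields with `|f|₂ ≤ 1`. -/
def per (E : Set (ℝ × ℝ)) : ℝ≥0∞ :=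
  ⨆ f ∈ {f : ℝ × ℝ → ℝ × ℝ |
      ContDiff ℝ (⊤ : ℕ∞) f ∧ HasCompactSupport f ∧ ∀ x, eNorm2 (f x) ≤ 1},
    ENNReal.ofReal (∫ x in E, div2 f x)

/-- The restricted surface energy `I_τ(∂E)`: the supremum of `∫_E div f` over smooth
vector fields compactly supported in the open square with `τ*(f) ≤ 1`. -/
def surfE (τ : ℝ × ℝ → ℝ) (E : Set (ℝ × ℝ)) : ℝ≥0∞ :=
  ⨆ f ∈ {f : ℝ × ℝ → ℝ × ℝ |
      ContDiff ℝ (⊤ : ℕ∞) f ∧ HasCompactSupport f ∧ tsupport f ⊆ Osq ∧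
        ∀ x, dualNorm τ (f x) ≤ 1},
    ENNReal.ofReal (∫ x in E, div2 f x)

/-- `E ∈ 𝒞`: `E` is a subset of `[-1,1]²` of finite perimeter. -/
def MemC (E : Set (ℝ × ℝ)) : Prop := E ⊆ Isq ∧ per E ≠ ⊤

open Classical in
/-- The conductance `I_τ(∂E)/Leb(E)` of `E`, with the convention `0/0 = ∞`. -/
def conduct (τ : ℝ × ℝ → ℝ) (E : Set (ℝ × ℝ)) : ℝ≥0∞ :=
  if volume E = 0 then ⊤ else surfE τ E / volume E

/-- The optimal conductance `ψ_τ^(a)` over sets of finite perimeter in the square. -/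
def psi (τ : ℝ × ℝ → ℝ) (a : ℝ) : ℝ≥0∞ :=
  ⨅ E ∈ {E : Set (ℝ × ℝ) | MemC E ∧ volume E ≤ ENNReal.ofReal a}, conduct τ E

/-- The set of optimizers `𝒞_τ^(a)`. -/
def Copt (τ : ℝ × ℝ → ℝ) (a : ℝ) : Set (Set (ℝ × ℝ)) :=
  {E | MemC E ∧ volume E ≤ ENNReal.ofReal a ∧ conduct τ E = psi τ a}

/-- A set of finite perimeter is decomposable if it can be split into two parts of positive
measure whose perimeters add up to the perimeter of the whole. -/
def Decomposable (E : Set (ℝ × ℝ)) : Prop :=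
  ∃ A B : Set (ℝ × ℝ), E = A ∪ B ∧ Disjoint A B ∧ 0 < volume A ∧ 0 < volume B ∧
    per E = per A + per B

/-- The length of the curve `γ` measured with the gauge `β`: the supremum, over partitions
`0 = t₀ ≤ t₁ ≤ ⋯ ≤ t_n = 1`, of `∑ β(γ(t_j) - γ(t_{j-1}))`. -/
def varLength (β : ℝ × ℝ → ℝ) (γ : ℝ → ℝ × ℝ) : ℝ≥0∞ :=
  ⨆ (n : ℕ) (t : Fin (n + 1) → ℝ)
    (_ : Monotone t ∧ t 0 = 0 ∧ t (Fin.last n) = 1),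
    ENNReal.ofReal (∑ i : Fin n, β (γ (t i.succ) - γ (t i.castSucc)))

/-- `C` is a rectifiable Jordan curve: the image of a continuous injective map of the unit
circle (equivalently, a continuous `1`-periodic map injective on `[0,1)`) of finite length. -/
def IsRectJordanCurve (C : Set (ℝ × ℝ)) : Prop :=
  ∃ γ : ℝ → ℝ × ℝ, Continuous γ ∧ (∀ t, γ (t + 1) = γ t) ∧
    Set.InjOn γ (Set.Ico 0 1) ∧ C = γ '' Set.Icc 0 1 ∧ varLength eNorm2 γ ≠ ⊤

/-- The hull of a curve `C`: the union of `C` with all bounded connected components of its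
complement. -/
def hullSet (C : Set (ℝ × ℝ)) : Set (ℝ × ℝ) :=
  C ∪ {x | x ∉ C ∧ Bornology.IsBounded (connectedComponentIn Cᶜ x)}

/-- `R ∈ ℛ`: `R` is a compact subset of the square with nonempty interior whose boundary is
a finite union of rectifiable Jordan curves, any two of which have `ℋ¹`-null intersection. -/
def MemR (R : Set (ℝ × ℝ)) : Prop :=
  IsCompact R ∧ R ⊆ Isq ∧ (interior R).Nonempty ∧
    ∃ F : Finset (Set (ℝ × ℝ)),
      (∀ C ∈ F, IsRectJordanCurve C) ∧ frontier R = ⋃ C ∈ F, C ∧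
        ∀ C ∈ F, ∀ C' ∈ F, C ≠ C' →
          (MeasureTheory.Measure.hausdorffMeasure 1 : Measure (ℝ × ℝ)) (C ∩ C') = 0

/-- The optimal conductance `φ_τ^(a)` over the class `ℛ`. -/
def phiR (τ : ℝ × ℝ → ℝ) (a : ℝ) : ℝ≥0∞ :=
  ⨅ R ∈ {R : Set (ℝ × ℝ) | MemR R ∧ volume R ≤ ENNReal.ofReal a}, conduct τ R

/-- The set of optimizers `ℛ_τ^(a)`. -/
def Ropt (τ : ℝ × ℝ → ℝ) (a : ℝ) : Set (Set (ℝ × ℝ)) :=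
  {R | MemR R ∧ volume R ≤ ENNReal.ofReal a ∧ conduct τ R = phiR τ a}

/-- `L¹` convergence of sets: `Leb(E_k Δ E₀) → 0`. -/
def TendstoL1 (E : ℕ → Set (ℝ × ℝ)) (E₀ : Set (ℝ × ℝ)) : Prop :=
  Tendsto (fun k => volume (symmDiff (E k) E₀)) atTop (nhds 0)

/-- `ρ` is a (piecewise-linear) polygonal curve on `[0,1]`. -/
def IsPolygonal (ρ : ℝ → ℝ × ℝ) : Prop :=
  ∃ (n : ℕ) (s : Fin (n + 1) → ℝ), Monotone s ∧ s 0 = 0 ∧ s (Fin.last n) = 1 ∧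
    ∀ i : Fin n, ∀ t ∈ Set.Icc (s i.castSucc) (s i.succ),
      ρ t = ρ (s i.castSucc) +
        ((t - s i.castSucc) / (s i.succ - s i.castSucc)) • (ρ (s i.succ) - ρ (s i.castSucc))

end

lemma norm2_upper {τ : ℝ × ℝ → ℝ} (hτ : IsNorm2 τ) : ∃ M : ℝ, 0 < M ∧ ∀ v, |τ v| ≤ M * ‖v‖ := by
  obtain ⟨h0, hs, ht⟩ := hτ
  have hnn : ∀ v, 0 ≤ τ v := by
    intro v
    have h1 := ht v ((-1 : ℝ) • v)
    rw [hs] at h1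
    have h2 : τ (v + (-1 : ℝ) • v) = 0 := by rw [h0]; simp
    rw [h2] at h1
    norm_num at h1
    linarith
  refine ⟨τ (1, 0) + τ (0, 1) + 1, by have := hnn (1,0); have := hnn (0,1); linarith, fun v => ?_⟩
  rw [abs_of_nonneg (hnn v)]
  have hv : v = v.1 • ((1 : ℝ), (0 : ℝ)) + v.2 • ((0 : ℝ), (1 : ℝ)) := by ext <;> simp
  have h1 : τ v ≤ |v.1| * τ (1, 0) + |v.2| * τ (0, 1) := by
    conv_lhs => rw [hv]
    refine (ht _ _).trans ?_
    rw [hs, hs]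
  have h3 : |v.1| ≤ ‖v‖ := norm_fst_le v
  have h4 : |v.2| ≤ ‖v‖ := norm_snd_le v
  have h5 := mul_le_mul_of_nonneg_right h3 (hnn (1, 0))
  have h6 := mul_le_mul_of_nonneg_right h4 (hnn (0, 1))
  have := norm_nonneg v
  linarith

lemma norm2_lower {τ : ℝ × ℝ → ℝ} (hτ : IsNorm2 τ) : ∃ m : ℝ, 0 < m ∧ ∀ v, m * ‖v‖ ≤ τ v := by
  obtain ⟨M, hM, hup⟩ := norm2_upper hτ
  obtain ⟨h0, hs, ht⟩ := hτ
  have hnn : ∀ v, 0 ≤ τ v := by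
    intro v
    have h1 := ht v ((-1 : ℝ) • v)
    rw [hs] at h1
    have h2 : τ (v + (-1 : ℝ) • v) = 0 := by rw [h0]; simp
    rw [h2] at h1
    norm_num at h1
    linarith
  have hsub : ∀ v w, τ v - τ w ≤ M * ‖v - w‖ := by
    intro v w
    have := ht (v - w) w
    rw [sub_add_cancel] at this
    have h2 := (le_abs_self _).trans (hup (v - w))
    linarith
  have hc : Continuous τ := by
    have : LipschitzWith M.toNNReal τ := by
      refine LipschitzWith.of_dist_le_mul fun v w => ?_
      rw [Real.dist_eq, dist_eq_norm, abs_le]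
      have h1 := hsub v w
      have h2 := hsub w v
      rw [norm_sub_rev] at h2
      rw [Real.coe_toNNReal _ hM.le]
      constructor <;> linarith
    exact this.continuous
  have hne : (Metric.sphere (0 : ℝ × ℝ) 1).Nonempty := ⟨(1, 0), by simp [Prod.norm_def]⟩
  obtain ⟨x, hx, hmin⟩ := (isCompact_sphere (0 : ℝ × ℝ) 1).exists_isMinOn hne hc.continuousOn
  have hx1 : ‖x‖ = 1 := by simpa using hx
  refine ⟨τ x, ?_, fun v => ?_⟩
  · refine lt_of_le_of_ne (hnn x) fun h => ?_
    have := (h0 x).1 h.symm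
    rw [this] at hx1
    simp at hx1
  · by_cases hv : v = 0
    · subst hv; simp [hnn]
    · have hv' : 0 < ‖v‖ := norm_pos_iff.2 hv
      have hmem : ‖v‖⁻¹ • v ∈ Metric.sphere (0 : ℝ × ℝ) 1 := by
        simp [norm_smul, hv'.ne']
      have h := hmin hmem
      change τ x ≤ τ (‖v‖⁻¹ • v) at h
      rw [hs, abs_of_pos (inv_pos.2 hv')] at h
      calc τ x * ‖v‖ ≤ (‖v‖⁻¹ * τ v) * ‖v‖ := by gcongr
        _ = τ v := by field_simp

lemma dualNorm_upper {τ : ℝ × ℝ → ℝ} (hτ : IsNorm2 τ) :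
    ∃ C : ℝ, 0 < C ∧ ∀ w, dualNorm τ w ≤ C * ‖w‖ ∧
      ∀ v, τ v ≤ 1 → v.1 * w.1 + v.2 * w.2 ≤ dualNorm τ w := by
  obtain ⟨m, hm, hlow⟩ := norm2_lower hτ
  refine ⟨2 * m⁻¹, by positivity, fun w => ?_⟩
  have key : ∀ v, τ v ≤ 1 → v.1 * w.1 + v.2 * w.2 ≤ 2 * m⁻¹ * ‖w‖ := by
    intro v hv
    have h1 : ‖v‖ ≤ m⁻¹ := by
      rw [← one_div, le_div_iff₀ hm, mul_comm]
      exact (hlow v).trans hv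
    have h3 : |v.1| ≤ ‖v‖ := norm_fst_le v
    have h4 : |v.2| ≤ ‖v‖ := norm_snd_le v
    have h5 : |w.1| ≤ ‖w‖ := norm_fst_le w
    have h6 : |w.2| ≤ ‖w‖ := norm_snd_le w
    have h7 : v.1 * w.1 ≤ m⁻¹ * ‖w‖ := by
      refine (le_abs_self _).trans ?_
      rw [abs_mul]
      exact mul_le_mul (h3.trans h1) h5 (abs_nonneg _) (by positivity)
    have h8 : v.2 * w.2 ≤ m⁻¹ * ‖w‖ := by
      refine (le_abs_self _).trans ?_
      rw [abs_mul]
      exact mul_le_mul (h4.trans h1) h6 (abs_nonneg _) (by positivity)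
    linarith
  constructor
  · refine csSup_le ⟨0, 0, ?_, by simp⟩ ?_
    · rw [(hτ.1 0).2 rfl]; norm_num
    · rintro x ⟨v, hv, rfl⟩
      exact key v hv
  · intro v hv
    refine le_csSup ⟨2 * m⁻¹ * ‖w‖, ?_⟩ ⟨v, hv, rfl⟩
    rintro x ⟨v, hv, rfl⟩
    exact key v hv

lemma dualNorm_lower {τ : ℝ × ℝ → ℝ} (hτ : IsNorm2 τ) :
    ∃ C : ℝ, 0 < C ∧ ∀ w, dualNorm τ w ≤ 1 → ‖w‖ ≤ C := by
  obtain ⟨M, hM, hup⟩ := norm2_upper hτ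
  obtain ⟨C, hC, h⟩ := dualNorm_upper hτ
  refine ⟨M, hM, fun w hw => ?_⟩
  have key : ∀ v : ℝ × ℝ, ‖v‖ ≤ 1 → v.1 * w.1 + v.2 * w.2 ≤ M := by
    intro v hv
    have h1 : τ (M⁻¹ • v) ≤ 1 := by
      refine (le_abs_self _).trans ((hup _).trans ?_)
      rw [norm_smul, Real.norm_eq_abs, abs_of_pos (inv_pos.2 hM), ← mul_assoc,
        mul_inv_cancel₀ hM.ne', one_mul]
      exact hv
    have h2 := ((h w).2 _ h1).trans hw
    simp only [Prod.smul_fst, Prod.smul_snd, smul_eq_mul] at h2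
    have h3 : M⁻¹ * (v.1 * w.1 + v.2 * w.2) ≤ 1 := by linarith
    rwa [inv_mul_le_iff₀ hM, mul_one] at h3
  have e1 := key (1, 0) (by simp [Prod.norm_def])
  have e2 := key (-1, 0) (by simp [Prod.norm_def])
  have e3 := key (0, 1) (by simp [Prod.norm_def])
  have e4 := key (0, -1) (by simp [Prod.norm_def])
  simp at e1 e2 e3 e4
  rw [Prod.norm_def]
  simp only [Real.norm_eq_abs]
  exact max_le (abs_le.2 ⟨by linarith, by linarith⟩) (abs_le.2 ⟨by linarith, by linarith⟩)

lemma div2_const_smul (c : ℝ) {f : ℝ × ℝ → ℝ × ℝ} (hf : Differentiable ℝ f) (x : ℝ × ℝ) :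
    div2 (fun y => c • f y) x = c * div2 f x := by
  unfold div2
  have : fderiv ℝ (fun y => c • f y) x = c • fderiv ℝ f x := fderiv_const_smul (hf x) c
  rw [this]
  simp
  ring

lemma div2_smul {u : ℝ × ℝ → ℝ} {f : ℝ × ℝ → ℝ × ℝ} (hu : Differentiable ℝ u)
    (hf : Differentiable ℝ f) (x : ℝ × ℝ) :
    div2 (fun y => u y • f y) x = u x * div2 f x + fderiv ℝ u x (f x) := by
  unfold div2
  have : fderiv ℝ (fun y => u y • f y) x = u x • fderiv ℝ f x + (fderiv ℝ u x).smulRight (f x) :=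
    fderiv_fun_smul (hu x) (hf x)
  rw [this]
  have h2 : fderiv ℝ u x (f x) = (f x).1 * fderiv ℝ u x (1, 0) + (f x).2 * fderiv ℝ u x (0, 1) := by
    have hv : f x = (f x).1 • ((1 : ℝ), (0 : ℝ)) + (f x).2 • ((0 : ℝ), (1 : ℝ)) := by
      ext <;> simp
    conv_lhs => rw [hv]
    rw [map_add, map_smul, map_smul]
    simp
  rw [h2]
  simp
  ring

lemma surfE_test {τ : ℝ × ℝ → ℝ} (hτ : IsNorm2 τ) : ∃ C : ℝ, 0 < C ∧
    ∀ (E : Set (ℝ × ℝ)) (f : ℝ × ℝ → ℝ × ℝ) (B : ℝ), surfE τ E ≠ ⊤ → 0 < B →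
      ContDiff ℝ (⊤ : ℕ∞) f → HasCompactSupport f → tsupport f ⊆ Osq → (∀ x, ‖f x‖ ≤ B) →
      ∫ x in E, div2 f x ≤ C * B * (surfE τ E).toReal := by
  obtain ⟨C, hC, h⟩ := dualNorm_upper hτ
  refine ⟨C, hC, fun E f B hE hB hf hfc hfs hfB => ?_⟩
  have hCB : 0 < C * B := by positivity
  have hd : Differentiable ℝ f := hf.differentiable (by simp)
  have h1 : ENNReal.ofReal (∫ x in E, div2 (fun y => (C * B)⁻¹ • f y) x) ≤ surfE τ E := by
    unfold surfE
    refine le_iSup₂ (f := fun (f : ℝ × ℝ → ℝ × ℝ) _ => ENNReal.ofReal (∫ x in E, div2 f x))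
      (fun y => (C * B)⁻¹ • f y) ⟨hf.const_smul _, ?_, ?_, ?_⟩
    · exact hfc.smul_left (f := fun _ => (C * B)⁻¹)
    · exact (tsupport_smul_subset_right (fun _ => (C * B)⁻¹) f).trans hfs
    · intro x
      refine ((h _).1).trans ?_
      rw [norm_smul, Real.norm_eq_abs, abs_of_pos (inv_pos.2 hCB)]
      calc C * ((C * B)⁻¹ * ‖f x‖) ≤ C * ((C * B)⁻¹ * B) := by gcongr; exact hfB x
        _ = 1 := by field_simp
  have h2 := (ENNReal.ofReal_le_iff_le_toReal hE).1 h1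
  simp_rw [div2_const_smul _ hd] at h2
  rw [integral_const_mul, inv_mul_le_iff₀ hCB] at h2
  exact h2

lemma div2_continuous {f : ℝ × ℝ → ℝ × ℝ} (hf : ContDiff ℝ (⊤ : ℕ∞) f) : Continuous (div2 f) := by
  have := hf.continuous_fderiv (by simp)
  unfold div2
  fun_prop

lemma box_bound {f : ℝ × ℝ → ℝ × ℝ} {C : ℝ} (hf : ContDiff ℝ (⊤ : ℕ∞) f) (hC : ∀ x, ‖f x‖ ≤ C) :
    ∫ x in Set.Icc ((0 : ℝ), (0 : ℝ)) (1, 1), div2 f x ≤ 4 * C := by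
  have hd : Differentiable ℝ f := hf.differentiable (by simp)
  have hI : IntegrableOn (div2 f) (Set.Icc ((0 : ℝ), (0 : ℝ)) (1, 1)) :=
    (div2_continuous hf).continuousOn.integrableOn_compact isCompact_Icc
  have key := integral_divergence_prod_Icc_of_hasFDerivAt_of_le (fun x => (f x).1)
    (fun x => (f x).2) (fun x => (ContinuousLinearMap.fst ℝ ℝ ℝ).comp (fderiv ℝ f x))
    (fun x => (ContinuousLinearMap.snd ℝ ℝ ℝ).comp (fderiv ℝ f x)) (0, 0) (1, 1)
    (by simp)
    (hf.continuous.fst.continuousOn) (hf.continuous.snd.continuousOn)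
    (fun x _ => (hd x).hasFDerivAt.fst)
    (fun x _ => (hd x).hasFDerivAt.snd) hI
  have e : (∫ x in Set.Icc ((0 : ℝ), (0 : ℝ)) (1, 1), div2 f x) = _ := key
  rw [e]
  have b1 : ∀ x, ‖(f x).1‖ ≤ C := fun x => (norm_fst_le _).trans (hC x)
  have b2 : ∀ x, ‖(f x).2‖ ≤ C := fun x => (norm_snd_le _).trans (hC x)
  have c1 : ∀ y : ℝ, |∫ x in (0:ℝ)..1, (f (x, y)).2| ≤ C := fun y => by
    have := intervalIntegral.norm_integral_le_of_norm_le_const (a := 0) (b := 1)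
      (f := fun x => (f (x, y)).2) (C := C) (fun x _ => b2 _)
    simpa using this
  have c2 : ∀ x : ℝ, |∫ y in (0:ℝ)..1, (f (x, y)).1| ≤ C := fun x => by
    have := intervalIntegral.norm_integral_le_of_norm_le_const (a := 0) (b := 1)
      (f := fun y => (f (x, y)).1) (C := C) (fun y _ => b1 _)
    simpa using this
  have d1 := abs_le.1 (c1 1)
  have d2 := abs_le.1 (c1 0)
  have d3 := abs_le.1 (c2 1)
  have d4 := abs_le.1 (c2 0)
  simp only
  linarith [d1.2, d2.1, d3.2, d4.1]

lemma norm_le_eNorm2 (v : ℝ × ℝ) : ‖v‖ ≤ eNorm2 v := by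
  unfold eNorm2
  rw [Prod.norm_def]
  exact max_le (Real.abs_le_sqrt (by nlinarith [sq_nonneg v.2]))
    (Real.abs_le_sqrt (by nlinarith [sq_nonneg v.1]))

lemma psi_lt_top {τ : ℝ × ℝ → ℝ} (hτ : IsNorm2 τ) {a : ℝ} (ha : 1 ≤ a) : psi τ a ≠ ⊤ := by
  have hv : volume (Set.Icc ((0 : ℝ), (0 : ℝ)) (1, 1)) = 1 := by
    rw [← Set.Icc_prod_Icc, Measure.volume_eq_prod, Measure.prod_prod]
    simp
  have hper : per (Set.Icc ((0 : ℝ), (0 : ℝ)) (1, 1)) ≤ ENNReal.ofReal (4 * 1) := by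
    unfold per
    refine iSup₂_le fun f hf => ENNReal.ofReal_le_ofReal ?_
    exact box_bound hf.1 fun x => (norm_le_eNorm2 _).trans (hf.2.2 x)
  obtain ⟨C, hC, h⟩ := dualNorm_lower hτ
  have hs : surfE τ (Set.Icc ((0 : ℝ), (0 : ℝ)) (1, 1)) ≤ ENNReal.ofReal (4 * C) := by
    unfold surfE
    refine iSup₂_le fun f hf => ENNReal.ofReal_le_ofReal ?_
    exact box_bound hf.1 fun x => h _ (hf.2.2.2 x)
  have hle : psi τ a ≤ conduct τ (Set.Icc ((0 : ℝ), (0 : ℝ)) (1, 1)) := by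
    unfold psi
    refine iInf₂_le _ ⟨⟨?_, ne_top_of_le_ne_top ENNReal.ofReal_ne_top hper⟩, ?_⟩
    · unfold Isq
      apply Set.Icc_subset_Icc <;> simp
    · rw [hv]
      simpa using ha
  refine ne_top_of_le_ne_top ?_ hle
  unfold conduct
  rw [hv]
  simp only [one_ne_zero, if_false, div_one]
  exact ne_top_of_le_ne_top ENNReal.ofReal_ne_top hs

lemma avg_hasFDerivAt {F : Type} [NormedAddCommGroup F] [NormedSpace ℝ F] [CompleteSpace F]
    (h : ℝ × ℝ) {u : ℝ × ℝ → F} (hu : ContDiff ℝ 1 u) (hc : HasCompactSupport u) (x : ℝ × ℝ) :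
    HasFDerivAt (fun x => ∫ s in (0 : ℝ)..1, u (x - s • h))
      (∫ s in (0 : ℝ)..1, fderiv ℝ u (x - s • h)) x := by
  have hcd : Continuous (fderiv ℝ u) := hu.continuous_fderiv (by simp)
  obtain ⟨K, hK⟩ := hcd.bounded_above_of_compact_support (hc.fderiv (𝕜 := ℝ))
  have hcu := hu.continuous
  have hd : Differentiable ℝ u := hu.differentiable (by simp)
  refine intervalIntegral.hasFDerivAt_integral_of_dominated_of_fderiv_le (𝕜 := ℝ)
    (F := fun x s => u (x - s • h)) (F' := fun x s => fderiv ℝ u (x - s • h))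
    (bound := fun _ => K) (s := Set.univ) Filter.univ_mem ?_ ?_ ?_ ?_ ?_ ?_
  · exact Filter.Eventually.of_forall fun x =>
      (by fun_prop : Continuous fun s : ℝ => u (x - s • h)).aestronglyMeasurable
  · exact (by fun_prop : Continuous fun s : ℝ => u (x - s • h)).intervalIntegrable _ _
  · exact (by fun_prop : Continuous fun s : ℝ => fderiv ℝ u (x - s • h)).aestronglyMeasurable
  · exact Filter.Eventually.of_forall fun s _ x _ => hK _
  · exact intervalIntegrable_const
  · refine Filter.Eventually.of_forall fun s _ x _ => ?_
    have := (hd (x - s • h)).hasFDerivAt.comp x ((hasFDerivAt_id x).sub_const (s • h))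
    rw [ContinuousLinearMap.comp_id] at this
    exact this

lemma avg_contDiff_nat (n : ℕ) : ∀ {F : Type} [NormedAddCommGroup F] [NormedSpace ℝ F]
    [CompleteSpace F] (h : ℝ × ℝ) {u : ℝ × ℝ → F} (_ : ContDiff ℝ (⊤ : ℕ∞) u)
    (_ : HasCompactSupport u), ContDiff ℝ n (fun x => ∫ s in (0 : ℝ)..1, u (x - s • h)) := by
  induction n with
  | zero =>
    intro F _ _ _ h u hu hc
    have : Differentiable ℝ (fun x => ∫ s in (0 : ℝ)..1, u (x - s • h)) := fun x =>
      (avg_hasFDerivAt h (hu.of_le (by simp)) hc x).differentiableAt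
    exact contDiff_zero.2 this.continuous
  | succ n ih =>
    intro F _ _ _ h u hu hc
    have h1 := fun x => avg_hasFDerivAt h (hu.of_le (by simp)) hc x
    rw [show ((n + 1 : ℕ) : WithTop ℕ∞) = (n : WithTop ℕ∞) + 1 by simp, contDiff_succ_iff_fderiv]
    refine ⟨fun x => (h1 x).differentiableAt, by simp, ?_⟩
    have h2 : fderiv ℝ (fun x => ∫ s in (0 : ℝ)..1, u (x - s • h)) =
        fun x => ∫ s in (0 : ℝ)..1, fderiv ℝ u (x - s • h) := by
      ext1 x; exact (h1 x).fderiv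
    rw [h2]
    exact ih h (hu.fderiv_right (by simp)) (hc.fderiv (𝕜 := ℝ))

lemma avg_contDiff (h : ℝ × ℝ) {u : ℝ × ℝ → ℝ} (hu : ContDiff ℝ (⊤ : ℕ∞) u)
    (hc : HasCompactSupport u) :
    ContDiff ℝ (⊤ : ℕ∞) (fun x => ∫ s in (0 : ℝ)..1, u (x - s • h)) :=
  contDiff_infty.2 fun n => avg_contDiff_nat n h hu hc

lemma avg_fderiv (h : ℝ × ℝ) {u : ℝ × ℝ → ℝ} (hu : ContDiff ℝ (⊤ : ℕ∞) u)
    (hc : HasCompactSupport u) (x : ℝ × ℝ) :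
    fderiv ℝ (fun x => ∫ s in (0 : ℝ)..1, u (x - s • h)) x h = u x - u (x - h) := by
  have hd : Differentiable ℝ u := hu.differentiable (by simp)
  have hcd : Continuous (fderiv ℝ u) := hu.continuous_fderiv (by simp)
  rw [(avg_hasFDerivAt h (hu.of_le (by simp)) hc x).fderiv]
  have hi : IntervalIntegrable (fun s : ℝ => fderiv ℝ u (x - s • h)) volume 0 1 :=
    (by fun_prop : Continuous fun s : ℝ => fderiv ℝ u (x - s • h)).intervalIntegrable _ _
  rw [ContinuousLinearMap.intervalIntegral_apply hi]
  have hder : ∀ s ∈ Set.uIcc (0 : ℝ) 1,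
      HasDerivAt (fun s : ℝ => - u (x - s • h)) (fderiv ℝ u (x - s • h) h) s := by
    intro s _
    have h1 : HasDerivAt (fun s : ℝ => x - s • h) (-h) s := by
      simpa using ((hasDerivAt_id s).smul_const h).const_sub x
    have h2 := ((hd (x - s • h)).hasFDerivAt.comp_hasDerivAt s h1).neg
    rw [map_neg, neg_neg] at h2
    exact h2
  rw [intervalIntegral.integral_eq_sub_of_hasDerivAt hder
    ((by fun_prop : Continuous fun s : ℝ => fderiv ℝ u (x - s • h) h).intervalIntegrable _ _)]
  simp
  ring

/-- Translation estimate. -/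
lemma translation_est {τ : ℝ × ℝ → ℝ} (hτ : IsNorm2 τ) : ∃ C : ℝ, 0 < C ∧
    ∀ (E : Set (ℝ × ℝ)) (u : ℝ × ℝ → ℝ) (h : ℝ × ℝ) (r : ℝ) (K : Set (ℝ × ℝ)),
      surfE τ E ≠ ⊤ → volume E ≠ ⊤ → 0 < r → ‖h‖ ≤ r →
      ContDiff ℝ (⊤ : ℕ∞) u → IsCompact K → (∀ x, x ∉ K → u x = 0) →
      (∀ x ∈ K, ∀ s ∈ Set.Icc (0 : ℝ) 1, x + s • h ∈ Osq) →
      (∀ x, 0 ≤ u x ∧ u x ≤ 1) →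
      ∫ x in E, u x ≤ (∫ x in E, u (x - h)) + C * r * (surfE τ E).toReal := by
  obtain ⟨C, hC, H⟩ := surfE_test hτ
  refine ⟨C, hC, fun E u h r K hE hvE hr hhr hu hK huK hKO hu01 => ?_⟩
  have hc : HasCompactSupport u := HasCompactSupport.intro hK huK
  set Φ : ℝ × ℝ → ℝ := fun x => ∫ s in (0 : ℝ)..1, u (x - s • h) with hΦ
  have hΦs : ContDiff ℝ (⊤ : ℕ∞) Φ := avg_contDiff h hu hc
  set K' : Set (ℝ × ℝ) := (fun p : (ℝ × ℝ) × ℝ => p.1 + p.2 • h) '' (K ×ˢ Set.Icc (0 : ℝ) 1)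
    with hK'
  have hK'c : IsCompact K' := (hK.prod isCompact_Icc).image (by fun_prop)
  have hΦ0 : ∀ x, x ∉ K' → Φ x = 0 := by
    intro x hx
    have : ∀ s ∈ Set.uIcc (0 : ℝ) 1, u (x - s • h) = 0 := by
      intro s hs
      rw [Set.uIcc_of_le zero_le_one] at hs
      refine huK _ fun hk => hx ⟨(x - s • h, s), ⟨hk, hs⟩, by simp⟩
    simp only [hΦ]
    rw [intervalIntegral.integral_congr (g := fun _ => 0) this]
    simp
  have hf0 : ∀ x, x ∉ K' → Φ x • h = 0 := fun x hx => by rw [hΦ0 x hx, zero_smul]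
  have hK'O : K' ⊆ Osq := by
    rintro _ ⟨⟨x, s⟩, ⟨hx, hs⟩, rfl⟩
    exact hKO x hx s hs
  have hΦ1 : ∀ x, |Φ x| ≤ 1 := by
    intro x
    have := intervalIntegral.norm_integral_le_of_norm_le_const (a := 0) (b := 1)
      (f := fun s : ℝ => u (x - s • h)) (C := 1) (fun s _ => by
        rw [Real.norm_eq_abs, abs_of_nonneg (hu01 _).1]; exact (hu01 _).2)
    simpa using this
  have key := H E (fun x => Φ x • h) r hE hr (hΦs.smul_const h)
    (HasCompactSupport.intro hK'c hf0)
    ((closure_minimal (fun x hx => by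
      by_contra hn; exact hx (hf0 x hn)) hK'c.isClosed).trans hK'O)
    (fun x => by
      rw [norm_smul, Real.norm_eq_abs]
      calc |Φ x| * ‖h‖ ≤ 1 * r := mul_le_mul (hΦ1 x) hhr (norm_nonneg _) zero_le_one
        _ = r := one_mul r)
  have hdiv : ∀ x, div2 (fun x => Φ x • h) x = u x - u (x - h) := by
    intro x
    rw [div2_smul (hΦs.differentiable (by simp)) (differentiable_const h)]
    rw [avg_fderiv h hu hc x]
    simp [div2]
  simp_rw [hdiv] at key
  have hi1 : Integrable u := hu.continuous.integrable_of_hasCompactSupport hc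
  rw [integral_sub hi1.integrableOn (hi1.comp_sub_right h).integrableOn] at key
  linarith

lemma vol_Isq : volume Isq = 4 := by
  unfold Isq
  rw [← Set.Icc_prod_Icc, Measure.volume_eq_prod, Measure.prod_prod]
  simp only [Real.volume_Icc]
  rw [← ENNReal.ofReal_mul (by norm_num)]
  norm_num

/-- The open square as a product of intervals. -/
def Tsq : Set (ℝ × ℝ) := Set.Ioo (-1 : ℝ) 1 ×ˢ Set.Ioo (-1 : ℝ) 1

lemma Tsq_subset : Tsq ⊆ Osq := by
  rintro ⟨x, y⟩ ⟨⟨h1, h2⟩, ⟨h3, h4⟩⟩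
  exact ⟨Prod.lt_iff.2 (Or.inl ⟨h1, h3.le⟩), Prod.lt_iff.2 (Or.inl ⟨h2, h4.le⟩)⟩

lemma isOpen_Tsq : IsOpen Tsq := isOpen_Ioo.prod isOpen_Ioo

lemma Tsq_subset_Isq : Tsq ⊆ Isq := by
  rintro ⟨x, y⟩ ⟨⟨h1, h2⟩, ⟨h3, h4⟩⟩
  exact ⟨⟨h1.le, h3.le⟩, ⟨h2.le, h4.le⟩⟩

lemma vol_Isq_diff : volume (Isq \ Tsq) = 0 := by
  have hT : volume Tsq = 4 := by
    unfold Tsq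
    rw [Measure.volume_eq_prod, Measure.prod_prod]
    simp only [Real.volume_Ioo]
    rw [← ENNReal.ofReal_mul (by norm_num)]
    norm_num
  rw [measure_sdiff Tsq_subset_Isq isOpen_Tsq.measurableSet.nullMeasurableSet (by rw [hT]; simp),
    hT, vol_Isq]
  simp

lemma half_split (K : Set (ℝ × ℝ)) (g : ℝ × ℝ → ℝ) :
    ∃ s : ℝ, (s = 1 ∨ s = -1) ∧ volume K ≤ 2 * volume (K ∩ {x | s * g x ≤ 0}) := by
  by_contra hcon
  push Not at hcon
  have h1 := hcon 1 (Or.inl rfl)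
  have h2 := hcon (-1) (Or.inr rfl)
  have hsub : K ⊆ (K ∩ {x | (1 : ℝ) * g x ≤ 0}) ∪ (K ∩ {x | (-1 : ℝ) * g x ≤ 0}) := by
    intro x hx
    rcases le_total (g x) 0 with h | h
    · left; exact ⟨hx, by simpa using h⟩
    · right; exact ⟨hx, by simpa using h⟩
  have h3 := (measure_mono hsub).trans (measure_union_le (μ := volume) _ _)
  have h4 := ENNReal.add_lt_add h1 h2
  rw [← mul_add] at h4
  have h5 : 2 * volume K ≤ 2 * (volume (K ∩ {x | (1 : ℝ) * g x ≤ 0}) +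
    volume (K ∩ {x | (-1 : ℝ) * g x ≤ 0})) := by gcongr
  rw [two_mul] at h5
  exact absurd h4 (not_lt.2 h5)

lemma iso_step {s x t h r : ℝ} (hs : s = 1 ∨ s = -1) (hx : x ∈ Set.Ioo (-1 : ℝ) 1)
    (hsx : s * x < 1 / 2) (hr : 0 ≤ r) (hr2 : r ≤ 1 / 2) (ht : t ∈ Set.Icc (0 : ℝ) 1)
    (hh : h ∈ Set.uIcc 0 (s * r)) : x + t * h ∈ Set.Ioo (-1 : ℝ) 1 ∧ |h| ≤ r := by
  obtain ⟨hx1, hx2⟩ := hx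
  obtain ⟨ht1, ht2⟩ := ht
  rcases hs with rfl | rfl
  · rw [one_mul, Set.uIcc_of_le hr] at hh
    obtain ⟨h1, h2⟩ := hh
    refine ⟨⟨by nlinarith, by nlinarith⟩, by rw [abs_le]; constructor <;> linarith⟩
  · rw [Set.uIcc_of_ge (by linarith)] at hh
    obtain ⟨h1, h2⟩ := hh
    refine ⟨⟨by nlinarith, by nlinarith⟩, by rw [abs_le]; constructor <;> linarith⟩

lemma vol_uIcc {s r : ℝ} (hs : s = 1 ∨ s = -1) (hr : 0 ≤ r) :
    volume (Set.uIcc 0 (s * r)) = ENNReal.ofReal r := by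
  rcases hs with rfl | rfl
  · rw [one_mul, Set.uIcc_of_le hr]; simp
  · rw [Set.uIcc_of_ge (by linarith)]; simp

open scoped Manifold ContDiff in
lemma smooth_urysohn {K K1 : Set (ℝ × ℝ)} (hK : IsClosed K) (h : K ⊆ interior K1) :
    ∃ u : ℝ × ℝ → ℝ, ContDiff ℝ (⊤ : ℕ∞) u ∧ (∀ x ∈ K, u x = 1) ∧ (∀ x, x ∉ K1 → u x = 0) ∧
      ∀ x, 0 ≤ u x ∧ u x ≤ 1 := by
  obtain ⟨f, h1, h2, h3⟩ := exists_contMDiffMap_one_nhds_of_subset_interior (n := (⊤ : ℕ∞))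
    𝓘(ℝ, ℝ × ℝ) hK h
  exact ⟨f, f.contMDiff.contDiff, fun x hx => h1.self_of_nhdsSet x hx, h2, h3⟩

lemma avg_bound {E W B K1 : Set (ℝ × ℝ)} {u : ℝ × ℝ → ℝ} {D : ℝ}
    (hBm : MeasurableSet B) (hu : ContDiff ℝ (⊤ : ℕ∞) u) (hK1 : IsCompact K1)
    (huK : ∀ x, x ∉ K1 → u x = 0) (hW : K1 ⊆ W) (hWm : MeasurableSet W)
    (hu01 : ∀ x, 0 ≤ u x ∧ u x ≤ 1) (hD : 0 ≤ D)
    (hest : ∀ h ∈ B, ∫ x in E, u x ≤ (∫ x in E, u (x - h)) + D) :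
    (∫⁻ x in E, ENNReal.ofReal (u x)) * volume B ≤
      volume E * volume W + ENNReal.ofReal D * volume B := by
  have hc : HasCompactSupport u := HasCompactSupport.intro hK1 huK
  have hi1 : Integrable u := hu.continuous.integrable_of_hasCompactSupport hc
  have hcu := hu.continuous
  have conv : ∀ h : ℝ × ℝ, ENNReal.ofReal (∫ x in E, u (x - h)) =
      ∫⁻ x in E, ENNReal.ofReal (u (x - h)) := fun h =>
    ofReal_integral_eq_lintegral_ofReal (hi1.comp_sub_right h).integrableOn
      (Filter.Eventually.of_forall fun x => (hu01 _).1)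
  have conv0 : ENNReal.ofReal (∫ x in E, u x) = ∫⁻ x in E, ENNReal.ofReal (u x) := by
    simpa using conv 0
  have hIntg : ∫⁻ x, ENNReal.ofReal (u x) ≤ volume W := by
    rw [← lintegral_indicator_one hWm]
    refine lintegral_mono fun x => ?_
    by_cases hx : x ∈ W
    · rw [Set.indicator_of_mem hx]
      simpa using (hu01 x).2
    · rw [huK x fun h => hx (hW h)]
      simp
  calc (∫⁻ x in E, ENNReal.ofReal (u x)) * volume B
      = ∫⁻ _ in B, (∫⁻ x in E, ENNReal.ofReal (u x)) := by rw [setLIntegral_const]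
    _ ≤ ∫⁻ h in B, ((∫⁻ x in E, ENNReal.ofReal (u (x - h))) + ENNReal.ofReal D) := by
        refine setLIntegral_mono' hBm fun h hh => ?_
        rw [← conv0, ← conv h, ← ENNReal.ofReal_add (integral_nonneg fun x => (hu01 _).1) hD]
        exact ENNReal.ofReal_le_ofReal (hest h hh)
    _ = (∫⁻ h in B, ∫⁻ x in E, ENNReal.ofReal (u (x - h))) + ENNReal.ofReal D * volume B := by
        rw [lintegral_add_right _ measurable_const, setLIntegral_const]
    _ ≤ volume E * volume W + ENNReal.ofReal D * volume B := by
        gcongr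
        rw [lintegral_lintegral_swap (by
          have : Continuous (Function.uncurry fun (h x : ℝ × ℝ) => ENNReal.ofReal (u (x - h))) := by
            exact ENNReal.continuous_ofReal.comp (by fun_prop)
          exact this.aemeasurable)]
        calc (∫⁻ x in E, ∫⁻ h in B, ENNReal.ofReal (u (x - h)))
            ≤ ∫⁻ _ in E, volume W := by
              refine lintegral_mono fun x => ?_
              refine (setLIntegral_le_lintegral _ _).trans ?_
              rw [lintegral_sub_left_eq_self (fun y => ENNReal.ofReal (u y)) x]
              exact hIntg
          _ = volume E * volume W := by rw [setLIntegral_const, mul_comm]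

/-- Relative isoperimetric inequality at small volume. -/
lemma isoperimetric {τ : ℝ × ℝ → ℝ} (hτ : IsNorm2 τ) : ∃ C : ℝ, 0 < C ∧
    ∀ E : Set (ℝ × ℝ), E ⊆ Isq → volume E ≠ 0 → volume E ≤ ENNReal.ofReal (1 / 16) →
      surfE τ E ≠ ⊤ →
      √(volume E).toReal ≤ C * (surfE τ E).toReal := by
  obtain ⟨C, hC, H⟩ := translation_est hτ
  refine ⟨32 * C, by positivity, fun E hE hE0 hEs hfin => ?_⟩
  have hEtop : volume E ≠ ⊤ := ne_top_of_le_ne_top ENNReal.ofReal_ne_top hEs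
  set V : ℝ := (volume E).toReal with hV
  have hVpos : 0 < V := ENNReal.toReal_pos hE0 hEtop
  have hVle : V ≤ 1 / 16 := ENNReal.toReal_le_of_le_ofReal (by norm_num) hEs
  have hVE : volume E = ENNReal.ofReal V := (ENNReal.ofReal_toReal hEtop).symm
  set P : ℝ := (surfE τ E).toReal with hP
  have hPnn : 0 ≤ P := ENNReal.toReal_nonneg
  set M := toMeasurable volume E with hM
  have hMm : MeasurableSet M := measurableSet_toMeasurable _ _
  have hA : volume (M ∩ Tsq) = volume E := by
    rw [hM, Measure.measure_toMeasurable_inter isOpen_Tsq.measurableSet hEtop]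
    refine le_antisymm (measure_mono Set.inter_subset_left) ?_
    calc volume E ≤ volume ((E ∩ Tsq) ∪ (Isq \ Tsq)) := by
          refine measure_mono fun x hx => ?_
          by_cases h : x ∈ Tsq
          · exact Or.inl ⟨hx, h⟩
          · exact Or.inr ⟨hE hx, h⟩
      _ ≤ volume (E ∩ Tsq) + volume (Isq \ Tsq) := measure_union_le _ _
      _ = volume (E ∩ Tsq) := by rw [vol_Isq_diff, add_zero]
  obtain ⟨K0, hK0A, hK0c, hK0v⟩ := (hMm.inter isOpen_Tsq.measurableSet).exists_lt_isCompact
    (μ := volume) (r := ENNReal.ofReal (V / 2)) (by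
      rw [hA, hVE]; exact (ENNReal.ofReal_lt_ofReal_iff hVpos).2 (by linarith))
  obtain ⟨s1, hs1, hK1v⟩ := half_split K0 (fun x => x.1)
  obtain ⟨s2, hs2, hK2v⟩ := half_split (K0 ∩ {x | s1 * x.1 ≤ 0}) (fun x => x.2)
  set K := (K0 ∩ {x | s1 * x.1 ≤ 0}) ∩ {x | s2 * x.2 ≤ 0} with hK
  have hKc : IsCompact K :=
    (hK0c.inter_right (isClosed_le (by fun_prop) (by fun_prop))).inter_right
      (isClosed_le (by fun_prop) (by fun_prop))
  have hKA : K ⊆ M ∩ Tsq := fun x hx => hK0A hx.1.1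
  have hKtop : volume K ≠ ⊤ := hKc.measure_lt_top.ne
  set k : ℝ := (volume K).toReal with hk
  have hKk : volume K = ENNReal.ofReal k := (ENNReal.ofReal_toReal hKtop).symm
  have hkV : V / 8 ≤ k := by
    have h1 : ENNReal.ofReal (V / 2) ≤ ENNReal.ofReal (2 * (2 * k)) := by
      rw [ENNReal.ofReal_mul (by norm_num), ENNReal.ofReal_mul (by norm_num), ← hKk]
      norm_num
      refine hK0v.le.trans (hK1v.trans ?_)
      gcongr
    have hknn : 0 ≤ k := ENNReal.toReal_nonneg
    have := (ENNReal.ofReal_le_ofReal_iff (by positivity)).1 h1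
    linarith
  have hkpos : 0 < k := by linarith
  obtain ⟨U, hKU, hUo, hUv⟩ := K.exists_isOpen_lt_of_lt (μ := volume) (ENNReal.ofReal (2 * k)) (by
    rw [hKk]; exact (ENNReal.ofReal_lt_ofReal_iff (by linarith)).2 (by linarith))
  set W : Set (ℝ × ℝ) := U ∩ (Tsq ∩ ({x | s1 * x.1 < 1 / 2} ∩ {x | s2 * x.2 < 1 / 2})) with hW
  have hWo : IsOpen W := hUo.inter (isOpen_Tsq.inter ((isOpen_lt (by fun_prop) (by fun_prop)).inter
    (isOpen_lt (by fun_prop) (by fun_prop))))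
  have hKW : K ⊆ W := by
    intro x hx
    have h1 : s1 * x.1 ≤ 0 := hx.1.2
    have h2 : s2 * x.2 ≤ 0 := hx.2
    exact ⟨hKU hx, (hKA hx).2, by change s1 * x.1 < 1 / 2; linarith,
      by change s2 * x.2 < 1 / 2; linarith⟩
  obtain ⟨K1, hK1c, hKK1, hK1W⟩ := exists_compact_between hKc hWo hKW
  obtain ⟨u, hu, hu1, hu0, hu01⟩ := smooth_urysohn hKc.isClosed hKK1
  set r : ℝ := 2 * √V with hr
  have hsq : √V * √V = V := Real.mul_self_sqrt hVpos.le
  have hsqpos : 0 < √V := Real.sqrt_pos.2 hVpos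
  have hrpos : 0 < r := by positivity
  have hr2 : r ≤ 1 / 2 := by
    have : √V ≤ 1 / 4 := Real.sqrt_le_iff.2 ⟨by norm_num, by norm_num; linarith⟩
    rw [hr]; linarith
  set B : Set (ℝ × ℝ) := Set.uIcc 0 (s1 * r) ×ˢ Set.uIcc 0 (s2 * r) with hB
  have hBv : volume B = ENNReal.ofReal (4 * V) := by
    rw [hB, Measure.volume_eq_prod, Measure.prod_prod, vol_uIcc hs1 hrpos.le, vol_uIcc hs2 hrpos.le,
      ← ENNReal.ofReal_mul hrpos.le]
    congr 1
    rw [hr]; linear_combination 4 * hsq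
  have hBm : MeasurableSet B := measurableSet_uIcc.prod measurableSet_uIcc
  have hest : ∀ h ∈ B, ∫ x in E, u x ≤ (∫ x in E, u (x - h)) + C * r * P := by
    rintro h ⟨hh1, hh2⟩
    refine H E u h r K1 hfin hEtop hrpos ?_ hu hK1c hu0 ?_ hu01
    · have e1 := (iso_step (x := 0) (t := 0) hs1 (by simp) (by simp) hrpos.le hr2
        (by simp) hh1).2
      have e2 := (iso_step (x := 0) (t := 0) hs2 (by simp) (by simp) hrpos.le hr2
        (by simp) hh2).2
      rw [Prod.norm_def]
      exact max_le e1 e2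
    · intro x hx s hs
      obtain ⟨_, hxT, hx1, hx2⟩ := hK1W hx
      exact Tsq_subset ⟨(iso_step hs1 hxT.1 hx1 hrpos.le hr2 hs hh1).1,
        (iso_step hs2 hxT.2 hx2 hrpos.le hr2 hs hh2).1⟩
  have key := avg_bound hBm hu hK1c hu0 hK1W hWo.measurableSet hu01
    (by positivity : 0 ≤ C * r * P) hest
  have hlow : volume K ≤ ∫⁻ x in E, ENNReal.ofReal (u x) := by
    rw [← Measure.restrict_toMeasurable hEtop]
    calc volume K = ∫⁻ _ in K, 1 := by simp
      _ ≤ ∫⁻ x in K, ENNReal.ofReal (u x) := by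
          refine setLIntegral_mono' hKc.measurableSet fun x hx => ?_
          rw [hu1 x hx]; simp
      _ ≤ ∫⁻ x in M, ENNReal.ofReal (u x) :=
          lintegral_mono_set fun x hx => (hKA hx).1
  have hWv : volume W ≤ ENNReal.ofReal (2 * k) := (measure_mono Set.inter_subset_left).trans hUv.le
  have key2 : ENNReal.ofReal (k * (4 * V)) ≤
      ENNReal.ofReal (V * (2 * k) + C * r * P * (4 * V)) := by
    rw [ENNReal.ofReal_add (by positivity) (by positivity), ENNReal.ofReal_mul hkpos.le,
      ENNReal.ofReal_mul hVpos.le,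
      ENNReal.ofReal_mul (by positivity : 0 ≤ C * r * P), ← hBv, ← hKk, ← hVE]
    refine (mul_le_mul_left hlow _).trans (key.trans ?_)
    gcongr
  have key3 := (ENNReal.ofReal_le_ofReal_iff (by positivity)).1 key2
  have key4 : k ≤ 2 * (C * r * P) := by
    have : V * (2 * k) ≤ V * (4 * (C * r * P)) := by linarith
    have := le_of_mul_le_mul_left this hVpos
    linarith
  have key5 : √V * √V ≤ √V * (32 * C * P) := by
    rw [hsq]
    rw [hr] at key4
    linarith
  exact le_of_mul_le_mul_left key5 hsqpos

/-- One-dimensional cutoff. -/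
noncomputable def chi (n : ℕ) (x : ℝ) : ℝ := Real.smoothTransition (n * (1 - x ^ 2) - 1)

lemma chi_contDiff (n : ℕ) : ContDiff ℝ (⊤ : ℕ∞) (chi n) := by
  unfold chi
  exact Real.smoothTransition.contDiff.comp (by fun_prop)

lemma chi_zero {n : ℕ} {x : ℝ} (h : n * (1 - x ^ 2) ≤ 1) : chi n x = 0 :=
  Real.smoothTransition.zero_of_nonpos (by linarith)

lemma chi_deriv (n : ℕ) (x : ℝ) : deriv (chi n) x =
    deriv Real.smoothTransition (n * (1 - x ^ 2) - 1) * (-(2 * n * x)) := by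
  have h1 : HasDerivAt (fun x : ℝ => (n : ℝ) * (1 - x ^ 2) - 1) (-(2 * n * x)) x := by
    have := (((hasDerivAt_pow 2 x).const_sub 1).const_mul (n : ℝ)).sub_const 1
    exact this.congr_deriv (by norm_num; ring)
  have h2 : DifferentiableAt ℝ Real.smoothTransition (n * (1 - x ^ 2) - 1) :=
    (Real.smoothTransition.contDiff (n := 1)).differentiable (by simp) _
  exact (h2.hasDerivAt.comp x h1).deriv

lemma chi_int (n : ℕ) : ∫ x in Set.Icc (-1 : ℝ) 1, |deriv (chi n) x| ≤ 2 := by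
  have hd : Differentiable ℝ (chi n) := (chi_contDiff n).differentiable (by simp)
  have hc : Continuous (deriv (chi n)) := (chi_contDiff n).continuous_deriv (by simp)
  have hS : ∀ t, 0 ≤ deriv Real.smoothTransition t := fun t =>
    Real.smoothTransition.monotone.deriv_nonneg
  have h01 : ∀ x, 0 ≤ chi n x ∧ chi n x ≤ 1 := fun x =>
    ⟨Real.smoothTransition.nonneg _, Real.smoothTransition.le_one _⟩
  rw [integral_Icc_eq_integral_Ioc, ← intervalIntegral.integral_of_le (by norm_num),
    ← intervalIntegral.integral_add_adjacent_intervals (b := 0)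
      (hc.abs.intervalIntegrable _ _) (hc.abs.intervalIntegrable _ _)]
  have e1 : ∫ x in (-1 : ℝ)..0, |deriv (chi n) x| = ∫ x in (-1 : ℝ)..0, deriv (chi n) x := by
    refine intervalIntegral.integral_congr fun x hx => ?_
    rw [Set.uIcc_of_le (by norm_num)] at hx
    refine abs_of_nonneg ?_
    rw [chi_deriv]
    refine mul_nonneg (hS _) ?_
    have := hx.2
    have : (n : ℝ) * x ≤ 0 := mul_nonpos_of_nonneg_of_nonpos (by positivity) this
    linarith
  have e2 : ∫ x in (0 : ℝ)..1, |deriv (chi n) x| = ∫ x in (0 : ℝ)..1, -deriv (chi n) x := by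
    refine intervalIntegral.integral_congr fun x hx => ?_
    rw [Set.uIcc_of_le (by norm_num)] at hx
    refine abs_of_nonpos ?_
    rw [chi_deriv]
    refine mul_nonpos_of_nonneg_of_nonpos (hS _) ?_
    have := hx.1
    have : 0 ≤ (n : ℝ) * x := by positivity
    linarith
  rw [e1, e2, intervalIntegral.integral_neg,
    intervalIntegral.integral_deriv_eq_sub (fun x _ => hd x) (hc.intervalIntegrable _ _),
    intervalIntegral.integral_deriv_eq_sub (fun x _ => hd x) (hc.intervalIntegrable _ _)]
  have a1 := h01 0
  have a2 := h01 1
  have a3 := h01 (-1)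
  linarith [a1.2, a2.1, a3.1]

/-- Two-dimensional cutoff. -/
noncomputable def cut (n : ℕ) (p : ℝ × ℝ) : ℝ := chi n p.1 * chi n p.2

lemma cut_contDiff (n : ℕ) : ContDiff ℝ (⊤ : ℕ∞) (cut n) :=
  ((chi_contDiff n).comp contDiff_fst).mul ((chi_contDiff n).comp contDiff_snd)

lemma chi_abs (n : ℕ) (x : ℝ) : |chi n x| ≤ 1 := by
  unfold chi
  rw [abs_of_nonneg (Real.smoothTransition.nonneg _)]
  exact Real.smoothTransition.le_one _

lemma cut_abs (n : ℕ) (p : ℝ × ℝ) : |cut n p| ≤ 1 := by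
  unfold cut
  rw [abs_mul]
  exact mul_le_one₀ (chi_abs n _) (abs_nonneg _) (chi_abs n _)

lemma cut_fderiv (n : ℕ) (p v : ℝ × ℝ) (hv : ‖v‖ ≤ 1) :
    |fderiv ℝ (cut n) p v| ≤ |deriv (chi n) p.1| + |deriv (chi n) p.2| := by
  have hd : Differentiable ℝ (chi n) := (chi_contDiff n).differentiable (by simp)
  have h1 : HasFDerivAt (fun p : ℝ × ℝ => chi n p.1)
      (deriv (chi n) p.1 • ContinuousLinearMap.fst ℝ ℝ ℝ) p :=
    (hd p.1).hasDerivAt.comp_hasFDerivAt p hasFDerivAt_fst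
  have h2 : HasFDerivAt (fun p : ℝ × ℝ => chi n p.2)
      (deriv (chi n) p.2 • ContinuousLinearMap.snd ℝ ℝ ℝ) p :=
    (hd p.2).hasDerivAt.comp_hasFDerivAt p hasFDerivAt_snd
  have h3 : fderiv ℝ (cut n) p = _ := (h1.mul h2).fderiv
  rw [h3]
  simp only [add_apply, smul_apply,
    ContinuousLinearMap.coe_fst', ContinuousLinearMap.coe_snd', smul_eq_mul]
  have hv1 : |v.1| ≤ 1 := (norm_fst_le v).trans hv
  have hv2 : |v.2| ≤ 1 := (norm_snd_le v).trans hv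
  have a1 : |chi n p.1 * (deriv (chi n) p.2 * v.2)| ≤ |deriv (chi n) p.2| := by
    rw [abs_mul, abs_mul]
    calc |chi n p.1| * (|deriv (chi n) p.2| * |v.2|) ≤ 1 * (|deriv (chi n) p.2| * 1) := by
          gcongr; exact chi_abs n _
      _ = _ := by ring
  have a2 : |chi n p.2 * (deriv (chi n) p.1 * v.1)| ≤ |deriv (chi n) p.1| := by
    rw [abs_mul, abs_mul]
    calc |chi n p.2| * (|deriv (chi n) p.1| * |v.1|) ≤ 1 * (|deriv (chi n) p.1| * 1) := by
          gcongr; exact chi_abs n _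
      _ = _ := by ring
  refine (abs_add_le _ _).trans ?_
  linarith

lemma Isq_eq : Isq = Set.Icc (-1 : ℝ) 1 ×ˢ Set.Icc (-1 : ℝ) 1 := by
  unfold Isq; rw [Set.Icc_prod_Icc]

lemma isCompact_Isq : IsCompact Isq := isCompact_Icc

lemma cut_int (n : ℕ) {E : Set (ℝ × ℝ)} (hE : E ⊆ Isq) (f : ℝ × ℝ → ℝ × ℝ) (hfc : Continuous f)
    (hf : ∀ x, ‖f x‖ ≤ 1) : |∫ x in E, fderiv ℝ (cut n) x (f x)| ≤ 8 := by
  have hcc : Continuous (fderiv ℝ (cut n)) := (cut_contDiff n).continuous_fderiv (by simp)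
  have hc : Continuous (deriv (chi n)) := (chi_contDiff n).continuous_deriv (by simp)
  have hI : volume.real (Set.Icc (-1 : ℝ) 1) = 2 := by
    simp [Measure.real]; norm_num
  have i1 : ∫ x in Isq, |deriv (chi n) x.1| ≤ 4 := by
    have := setIntegral_prod_mul (μ := (volume : Measure ℝ)) (ν := (volume : Measure ℝ))
      (fun x => |deriv (chi n) x|) (fun _ => (1 : ℝ)) (Set.Icc (-1 : ℝ) 1) (Set.Icc (-1 : ℝ) 1)
    rw [Isq_eq, Measure.volume_eq_prod]
    simp only [mul_one] at this
    rw [this]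
    have h2 := chi_int n
    simp only [setIntegral_const, hI, smul_eq_mul]
    linarith
  have i2 : ∫ x in Isq, |deriv (chi n) x.2| ≤ 4 := by
    have := setIntegral_prod_mul (μ := (volume : Measure ℝ)) (ν := (volume : Measure ℝ))
      (fun _ => (1 : ℝ)) (fun x => |deriv (chi n) x|) (Set.Icc (-1 : ℝ) 1) (Set.Icc (-1 : ℝ) 1)
    rw [Isq_eq, Measure.volume_eq_prod]
    simp only [one_mul] at this
    rw [this]
    have h2 := chi_int n
    simp only [setIntegral_const, hI, smul_eq_mul]
    linarith
  have j1 : IntegrableOn (fun x : ℝ × ℝ => |deriv (chi n) x.1|) Isq :=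
    (by fun_prop : Continuous fun x : ℝ × ℝ => |deriv (chi n) x.1|).continuousOn.integrableOn_compact
      isCompact_Isq
  have j2 : IntegrableOn (fun x : ℝ × ℝ => |deriv (chi n) x.2|) Isq :=
    (by fun_prop : Continuous fun x : ℝ × ℝ => |deriv (chi n) x.2|).continuousOn.integrableOn_compact
      isCompact_Isq
  have j3 : IntegrableOn (fun x : ℝ × ℝ => fderiv ℝ (cut n) x (f x)) Isq :=
    (by fun_prop : Continuous fun x : ℝ × ℝ =>
      fderiv ℝ (cut n) x (f x)).continuousOn.integrableOn_compact isCompact_Isq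
  calc |∫ x in E, fderiv ℝ (cut n) x (f x)| ≤ ∫ x in E, |fderiv ℝ (cut n) x (f x)| :=
        abs_integral_le_integral_abs
    _ ≤ ∫ x in Isq, |fderiv ℝ (cut n) x (f x)| :=
        setIntegral_mono_set j3.abs (Filter.Eventually.of_forall fun x => abs_nonneg _)
          (LE.le.eventuallyLE hE)
    _ ≤ ∫ x in Isq, (|deriv (chi n) x.1| + |deriv (chi n) x.2|) :=
        integral_mono j3.abs (j1.add j2) fun x => cut_fderiv n x _ (hf x)
    _ = (∫ x in Isq, |deriv (chi n) x.1|) + ∫ x in Isq, |deriv (chi n) x.2| :=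
        integral_add j1 j2
    _ ≤ 8 := by linarith

lemma cut_tendsto {p : ℝ × ℝ} (hp : p ∈ Tsq) :
    Tendsto (fun n => cut n p) atTop (nhds 1) := by
  have h1 : ∀ x ∈ Set.Ioo (-1 : ℝ) 1, ∀ᶠ n : ℕ in atTop, chi n x = 1 := by
    intro x hx
    have hpos : 0 < 1 - x ^ 2 := by nlinarith [hx.1, hx.2]
    filter_upwards [(tendsto_natCast_atTop_atTop (R := ℝ)).eventually_ge_atTop (2 / (1 - x ^ 2))]
      with n hn
    rw [div_le_iff₀ hpos] at hn
    exact Real.smoothTransition.one_of_one_le (by linarith)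
  refine tendsto_const_nhds.congr' ?_
  filter_upwards [h1 _ hp.1, h1 _ hp.2] with n a b
  simp [cut, a, b]

lemma per_finite {τ : ℝ × ℝ → ℝ} (hτ : IsNorm2 τ) {E : Set (ℝ × ℝ)} (hE : E ⊆ Isq)
    (hEm : MeasurableSet E) (hs : surfE τ E ≠ ⊤) : per E ≠ ⊤ := by
  obtain ⟨C, hC, H⟩ := surfE_test hτ
  suffices h : per E ≤ ENNReal.ofReal (C * 1 * (surfE τ E).toReal + 8) from
    ne_top_of_le_ne_top ENNReal.ofReal_ne_top h
  unfold per
  refine iSup₂_le fun f hf => ENNReal.ofReal_le_ofReal ?_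
  obtain ⟨hfs, hfc, hf1⟩ := hf
  have hfn : ∀ x, ‖f x‖ ≤ 1 := fun x => (norm_le_eNorm2 _).trans (hf1 x)
  have hdc := div2_continuous hfs
  have hcc : ∀ n, Continuous (fderiv ℝ (cut n)) := fun n =>
    (cut_contDiff n).continuous_fderiv (by simp)
  have hcutc : ∀ n, Continuous (cut n) := fun n => (cut_contDiff n).continuous
  have hfcont := hfs.continuous
  have hIntg : ∀ g : ℝ × ℝ → ℝ, Continuous g → IntegrableOn g E := fun g hg =>
    (hg.continuousOn.integrableOn_compact isCompact_Isq).mono_set hE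
  have hb : ∀ n, ∫ x in E, cut n x * div2 f x ≤ C * 1 * (surfE τ E).toReal + 8 := by
    intro n
    have hsub : tsupport (fun x => cut n x • f x) ⊆ Tsq := by
      have hcl : IsClosed {p : ℝ × ℝ | 1 ≤ (n : ℝ) * (1 - p.1 ^ 2) ∧
          1 ≤ (n : ℝ) * (1 - p.2 ^ 2)} :=
        IsClosed.and (isClosed_le (by fun_prop) (by fun_prop))
          (isClosed_le (by fun_prop) (by fun_prop))
      refine (closure_minimal ?_ hcl).trans ?_
      · intro p hp
        by_contra hcon
        apply hp
        have : cut n p = 0 := by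
          by_cases h1 : 1 ≤ (n : ℝ) * (1 - p.1 ^ 2)
          · have h2 : ¬ 1 ≤ (n : ℝ) * (1 - p.2 ^ 2) := fun h2 => hcon ⟨h1, h2⟩
            simp [cut, chi_zero (not_le.1 h2).le]
          · simp [cut, chi_zero (not_le.1 h1).le]
        simp [this]
      · rintro p ⟨h1, h2⟩
        have aux : ∀ x : ℝ, 1 ≤ (n : ℝ) * (1 - x ^ 2) → x ∈ Set.Ioo (-1 : ℝ) 1 := by
          intro x hx
          have hlt : x ^ 2 < 1 := by
            by_contra hcon
            have : (n : ℝ) * (1 - x ^ 2) ≤ 0 :=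
              mul_nonpos_of_nonneg_of_nonpos (by positivity) (by linarith)
            linarith
          exact abs_lt.1 ((sq_lt_one_iff_abs_lt_one x).1 hlt)
        exact ⟨aux _ h1, aux _ h2⟩
    have h1 := H E (fun x => cut n x • f x) 1 hs one_pos ((cut_contDiff n).smul hfs)
      (hfc.smul_left (f := cut n)) (hsub.trans Tsq_subset) (fun x => by
        rw [norm_smul]
        exact mul_le_one₀ (cut_abs n x) (norm_nonneg _) (hfn x))
    simp_rw [div2_smul ((cut_contDiff n).differentiable (by simp))
      (hfs.differentiable (by simp))] at h1
    have hcn := hcutc n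
    have hccn := hcc n
    rw [integral_add (hIntg _ (by fun_prop)) (hIntg _ (by fun_prop))] at h1
    have h2 := (abs_le.1 (cut_int n hE f hfcont hfn)).1
    linarith
  have hlim : Tendsto (fun n => ∫ x in E, cut n x * div2 f x) atTop
      (nhds (∫ x in E, div2 f x)) := by
    refine tendsto_integral_of_dominated_convergence (fun x => |div2 f x|) (fun n => ?_)
      (hIntg _ hdc.abs) (fun n => ?_) ?_
    · have := hcutc n
      exact (by fun_prop : Continuous fun x => cut n x * div2 f x).aestronglyMeasurable
    · refine Filter.Eventually.of_forall fun x => ?_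
      rw [norm_mul]
      exact mul_le_of_le_one_left (abs_nonneg _) (cut_abs n x)
    · have h1 : ∀ᵐ x ∂(volume : Measure (ℝ × ℝ)), x ∉ Isq \ Tsq := measure_eq_zero_iff_ae_notMem.1 vol_Isq_diff
      rw [ae_restrict_iff' hEm]
      filter_upwards [h1] with x hx hxE
      have hxT : x ∈ Tsq := by
        by_contra hn
        exact hx ⟨hE hxE, hn⟩
      simpa using (cut_tendsto hxT).mul_const (div2 f x)
  exact le_of_tendsto' hlim hb

lemma integral_tendsto {E : ℕ → Set (ℝ × ℝ)} {E₀ : Set (ℝ × ℝ)} (hE : ∀ k, E k ⊆ Isq)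
    (hm : MeasurableSet E₀) (hE₀ : E₀ ⊆ Isq) (hL : TendstoL1 E E₀) {g : ℝ × ℝ → ℝ}
    (hg : Continuous g) {D : ℝ} (hD : ∀ x, |g x| ≤ D) :
    Tendsto (fun k => ∫ x in E k, g x) atTop (nhds (∫ x in E₀, g x)) := by
  have hD0 : 0 ≤ D := (abs_nonneg _).trans (hD 0)
  have hfin : ∀ {S : Set (ℝ × ℝ)}, S ⊆ Isq → volume S ≠ ⊤ := fun {S} hS =>
    ne_top_of_le_ne_top (by rw [vol_Isq]; simp) (measure_mono hS)
  have hsd : ∀ k, volume (symmDiff (E k) E₀) ≠ ⊤ := fun k =>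
    hfin ((symmDiff_subset_union).trans (Set.union_subset (hE k) hE₀))
  have hbound : ∀ k, |(∫ x in E k, g x) - ∫ x in E₀, g x| ≤
      2 * D * (volume (symmDiff (E k) E₀)).toReal := by
    intro k
    have hEtop := hfin (hE k)
    rw [← Measure.restrict_toMeasurable hEtop]
    set M := toMeasurable volume (E k) with hM
    have hMm : MeasurableSet M := measurableSet_toMeasurable _ _
    have hMtop : volume M ≠ ⊤ := by rw [hM, measure_toMeasurable]; exact hEtop
    have hIntg : ∀ S : Set (ℝ × ℝ), volume S ≠ ⊤ → IntegrableOn g S := fun S hS =>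
      IntegrableOn.of_bound hS.lt_top hg.aestronglyMeasurable D
        (Filter.Eventually.of_forall hD)
    have e1 := integral_inter_add_sdiff (μ := volume) (f := g) (s := M) hm (hIntg M hMtop)
    have e2 := integral_inter_add_sdiff (μ := volume) (f := g) (s := E₀) hMm (hIntg E₀ (hfin hE₀))
    rw [Set.inter_comm] at e2
    have v1 : volume (M \ E₀) ≤ volume (symmDiff (E k) E₀) := by
      rw [Set.sdiff_eq, hM, Measure.measure_toMeasurable_inter hm.compl hEtop]
      exact measure_mono fun x hx => Or.inl hx
    have v2 : volume (E₀ \ M) ≤ volume (symmDiff (E k) E₀) :=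
      measure_mono fun x hx => Or.inr ⟨hx.1, fun h => hx.2 (subset_toMeasurable _ _ h)⟩
    have b : ∀ S : Set (ℝ × ℝ), volume S ≤ volume (symmDiff (E k) E₀) →
        |∫ x in S, g x| ≤ D * (volume (symmDiff (E k) E₀)).toReal := by
      intro S hS
      have h1 := norm_setIntegral_le_of_norm_le_const (μ := volume) (s := S) (f := g) (C := D)
        (lt_of_le_of_lt hS (hsd k).lt_top) (fun x _ => hD x)
      refine h1.trans ?_
      exact mul_le_mul_of_nonneg_left (ENNReal.toReal_mono (hsd k) hS) hD0
    have b1 := abs_le.1 (b _ v1)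
    have b2 := abs_le.1 (b _ v2)
    rw [abs_le]
    constructor <;> linarith [b1.1, b1.2, b2.1, b2.2]
  rw [tendsto_iff_dist_tendsto_zero]
  have hz : Tendsto (fun k => 2 * D * (volume (symmDiff (E k) E₀)).toReal) atTop (nhds 0) := by
    have h1 := (ENNReal.tendsto_toReal ENNReal.zero_ne_top).comp hL
    have h2 := h1.const_mul (2 * D)
    simpa using h2
  exact squeeze_zero (fun _ => dist_nonneg) hbound hz

lemma volume_tendsto {E : ℕ → Set (ℝ × ℝ)} {E₀ : Set (ℝ × ℝ)} (hE₀ : volume E₀ ≠ ⊤)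
    (hL : TendstoL1 E E₀) : Tendsto (fun k => volume (E k)) atTop (nhds (volume E₀)) := by
  have h1 : ∀ k, volume E₀ ≤ volume (E k) + volume (symmDiff (E k) E₀) := fun k => by
    refine (measure_mono ?_).trans (measure_union_le _ _)
    intro x hx
    by_cases h : x ∈ E k
    · exact Or.inl h
    · exact Or.inr (Or.inr ⟨hx, h⟩)
  have h2 : ∀ k, volume (E k) ≤ volume E₀ + volume (symmDiff (E k) E₀) := fun k => by
    refine (measure_mono ?_).trans (measure_union_le _ _)
    intro x hx
    by_cases h : x ∈ E₀
    · exact Or.inl h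
    · exact Or.inr (Or.inl ⟨hx, h⟩)
  have hL' : Tendsto (fun k => volume (symmDiff (E k) E₀)) atTop (nhds 0) := hL
  have t1 : Tendsto (fun k => volume E₀ - volume (symmDiff (E k) E₀)) atTop
      (nhds (volume E₀)) := by
    have := ENNReal.Tendsto.sub (tendsto_const_nhds (x := volume E₀) (f := atTop)) hL'
      (Or.inl hE₀)
    simpa using this
  have t2 : Tendsto (fun k => volume E₀ + volume (symmDiff (E k) E₀)) atTop
      (nhds (volume E₀)) := by
    have := (tendsto_const_nhds (x := volume E₀) (f := atTop)).add hL'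
    simpa using this
  exact tendsto_of_tendsto_of_tendsto_of_le_of_le t1 t2
    (fun k => tsub_le_iff_right.2 (h1 k)) h2

lemma liminf_pos {τ : ℝ × ℝ → ℝ} (hτ : IsNorm2 τ) {a : ℝ} (ha : 1 ≤ a)
    {E : ℕ → Set (ℝ × ℝ)} (hE : ∀ k, MemC (E k))
    (hconv : Tendsto (fun k => conduct τ (E k)) atTop (nhds (psi τ a))) :
    0 < Filter.liminf (fun k => volume (E k)) atTop := by
  obtain ⟨C, hC, H⟩ := isoperimetric hτ
  have hpsi := psi_lt_top hτ ha
  set Q : ℝ := (psi τ a).toReal + 1 with hQ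
  have hQpos : 0 < Q := by have : 0 ≤ (psi τ a).toReal := ENNReal.toReal_nonneg; linarith
  have hlt : psi τ a < ENNReal.ofReal Q := by
    rw [← ENNReal.ofReal_toReal hpsi]
    exact (ENNReal.ofReal_lt_ofReal_iff hQpos).2 (by simp [hQ])
  set c : ℝ := min (1 / 16) ((C * Q)⁻¹ ^ 2) with hc
  have hcpos : 0 < c := by positivity
  have hev : ∀ᶠ k in atTop, ENNReal.ofReal c ≤ volume (E k) := by
    filter_upwards [hconv.eventually_lt_const hlt] with k hk
    by_cases hbig : volume (E k) ≤ ENNReal.ofReal (1 / 16)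
    · have htop : volume (E k) ≠ ⊤ := ne_top_of_le_ne_top ENNReal.ofReal_ne_top hbig
      have h0 : volume (E k) ≠ 0 := by
        intro h0
        simp [conduct, h0] at hk
      simp only [conduct, h0, if_false] at hk
      set V : ℝ := (volume (E k)).toReal with hV
      have hVpos : 0 < V := ENNReal.toReal_pos h0 htop
      have hVE : volume (E k) = ENNReal.ofReal V := (ENNReal.ofReal_toReal htop).symm
      have hs : surfE τ (E k) ≤ ENNReal.ofReal (Q * V) := by
        rw [ENNReal.ofReal_mul hQpos.le, ← hVE]
        exact (ENNReal.div_le_iff h0 htop).1 hk.le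
      have hst : surfE τ (E k) ≠ ⊤ := ne_top_of_le_ne_top ENNReal.ofReal_ne_top hs
      have hiso := H (E k) (hE k).1 h0 hbig hst
      have hsr : (surfE τ (E k)).toReal ≤ Q * V :=
        ENNReal.toReal_le_of_le_ofReal (by positivity) hs
      have hsq : √V * √V = V := Real.mul_self_sqrt hVpos.le
      have hsqpos : 0 < √V := Real.sqrt_pos.2 hVpos
      have h1 : √V * 1 ≤ √V * ((C * Q) * √V) := by
        calc √V * 1 = √V := mul_one _
          _ ≤ C * (surfE τ (E k)).toReal := hiso
          _ ≤ C * (Q * V) := by gcongr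
          _ = √V * ((C * Q) * √V) := by linear_combination (- C * Q) * hsq
      have h2 := le_of_mul_le_mul_left h1 hsqpos
      have h3 : (C * Q)⁻¹ ≤ √V := by
        rw [inv_le_iff_one_le_mul₀' (by positivity)]; exact h2
      have h4 : (C * Q)⁻¹ ^ 2 ≤ V := by
        rw [← Real.sq_sqrt hVpos.le]
        gcongr
      rw [hVE]
      exact ENNReal.ofReal_le_ofReal ((min_le_right _ _).trans h4)
    · exact (ENNReal.ofReal_le_ofReal (min_le_left _ _)).trans (not_le.1 hbig).le
  exact lt_of_lt_of_le (ENNReal.ofReal_pos.2 hcpos) (Filter.le_liminf_of_le (by isBoundedDefault) hev)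

/-- A minimizing sequence for `ψ_τ^(2+α)` has volumes bounded away from `0`, and any of its
`L¹` limits is an optimizer. -/
theorem minimizing_sequence_limit (τ : ℝ × ℝ → ℝ) (hτ : IsNorm2 τ)
    (α : ℝ) (hα : α ∈ Set.Ioo (-1 : ℝ) 1)
    (E : ℕ → Set (ℝ × ℝ)) (hE : ∀ k, MemC (E k))
    (hvol : ∀ k, volume (E k) ≤ ENNReal.ofReal (2 + α))
    (hconv : Filter.Tendsto (fun k => conduct τ (E k)) Filter.atTop
      (nhds (psi τ (2 + α)))) :
    0 < Filter.liminf (fun k => volume (E k)) Filter.atTop ∧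
    ∀ E₀ : Set (ℝ × ℝ), MeasurableSet E₀ → E₀ ⊆ Isq → TendstoL1 E E₀ →
      E₀ ∈ Copt τ (2 + α) := by
  have ha : (1 : ℝ) ≤ 2 + α := by linarith [hα.1]
  have hpos := liminf_pos hτ ha hE hconv
  refine ⟨hpos, fun E₀ hm hE₀ hL => ?_⟩
  have hpsi := psi_lt_top hτ ha
  have hE₀top : volume E₀ ≠ ⊤ :=
    ne_top_of_le_ne_top (by rw [vol_Isq]; simp) (measure_mono hE₀)
  have hvt := volume_tendsto hE₀top hL
  rw [hvt.liminf_eq] at hpos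
  have hvle : volume E₀ ≤ ENNReal.ofReal (2 + α) := le_of_tendsto' hvt hvol
  have hst : Tendsto (fun k => surfE τ (E k)) atTop (nhds (psi τ (2 + α) * volume E₀)) := by
    have h1 := ENNReal.Tendsto.mul hconv (Or.inr hE₀top) hvt (Or.inr hpsi)
    refine h1.congr' ?_
    filter_upwards [hvt.eventually_const_lt hpos] with k hk
    have htop : volume (E k) ≠ ⊤ := ne_top_of_le_ne_top ENNReal.ofReal_ne_top (hvol k)
    simp only [conduct, hk.ne', if_false]
    exact ENNReal.div_mul_cancel hk.ne' htop
  have hsle : surfE τ E₀ ≤ psi τ (2 + α) * volume E₀ := by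
    conv_lhs => unfold surfE
    refine iSup₂_le fun f hf => ?_
    have hdc := div2_continuous hf.1
    obtain ⟨D, hD⟩ : ∃ D, ∀ x, ‖div2 f x‖ ≤ D := by
      refine hdc.bounded_above_of_compact_support ?_
      refine HasCompactSupport.intro (hf.2.1.fderiv (𝕜 := ℝ)) fun x hx => ?_
      have : fderiv ℝ f x = 0 := image_eq_zero_of_notMem_tsupport hx
      simp [div2, this]
    have ht := integral_tendsto (fun k => (hE k).1) hm hE₀ hL hdc hD
    refine le_of_tendsto_of_tendsto' ((ENNReal.continuous_ofReal.tendsto _).comp ht) hst fun k => ?_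
    exact le_iSup₂ (f := fun (f : ℝ × ℝ → ℝ × ℝ) _ => ENNReal.ofReal (∫ x in E k, div2 f x)) f hf
  have hsfin : surfE τ E₀ ≠ ⊤ := ne_top_of_le_ne_top (ENNReal.mul_ne_top hpsi hE₀top) hsle
  have hC : MemC E₀ := ⟨hE₀, per_finite hτ hE₀ hm hsfin⟩
  refine ⟨hC, hvle, le_antisymm ?_ ?_⟩
  · simp only [conduct, hpos.ne', if_false]
    exact (ENNReal.div_le_iff hpos.ne' hE₀top).2 hsle
  · unfold psi
    exact iInf₂_le E₀ ⟨hC, hvle⟩
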